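/- arXiv:1103.2312 — 2 statements merged into one kernel-verified Lean document; each statement's English description precedes it below -/
import Mathlib

section
/- Let E and F be countable Borel equivalence relations on standard Borel spaces X and Y respectively. If E ≤_B F and F is Borel bounded, then E is Borel bounded. -/
open Filter

/-- Eventual equality on `ℕ → ℕ`. -/
def EvEq (α β : ℕ → ℕ) : Prop := ∀ᶠ n in Filter.atTop, α n = β n

/-- Eventual domination on `ℕ → ℕ`. -/
def EvLe (α β : ℕ → ℕ) : Prop := ∀ᶠ n in Filter.atTop, α n ≤ β n

/-- `E` is Borel bounded: every Borel `φ : X → ℕ^ℕ` is eventually dominated by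
a Borel homomorphism `ψ` from `E` to `=*`. -/
def BorelBounded {X : Type*} [MeasurableSpace X] (E : X → X → Prop) : Prop :=
  ∀ φ : X → ℕ → ℕ, Measurable φ →
    ∃ ψ : X → ℕ → ℕ, Measurable ψ ∧ (∀ x y, E x y → EvEq (ψ x) (ψ y)) ∧
      ∀ x, EvLe (φ x) (ψ x)

open MeasureTheory Set Topology

/-- The intersection of two analytic sets is analytic. -/
theorem analyticSet_inter {α : Type*} [TopologicalSpace α] [T2Space α] {s t : Set α}
    (hs : AnalyticSet s) (ht : AnalyticSet t) : AnalyticSet (s ∩ t) := by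
  rw [inter_eq_iInter]
  exact AnalyticSet.iInter fun b => by cases b <;> assumption

/-- If a continuous map is injective on an analytic set, then it is injective on a Borel
superset of it. -/
theorem exists_measurableSet_injOn_of_analyticSet {X Y : Type*}
    [TopologicalSpace X] [PolishSpace X] [MeasurableSpace X] [BorelSpace X]
    [TopologicalSpace Y] [PolishSpace Y] [MeasurableSpace Y] [BorelSpace Y]
    {f : X → Y} (hf : Continuous f) {A : Set X} (hA : AnalyticSet A) (hinj : InjOn f A) :
    ∃ B, A ⊆ B ∧ MeasurableSet B ∧ InjOn f B := by
  obtain ⟨b, hbc, -, hb⟩ := TopologicalSpace.exists_countable_basis X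
  have hopen : ∀ U ∈ b, AnalyticSet (f '' (A ∩ U)) := fun U hU =>
    (analyticSet_inter hA (hb.isOpen hU).measurableSet.analyticSet).image_of_continuous hf
  have hsep : ∀ p : Set X × Set X, p ∈ {p ∈ b ×ˢ b | Disjoint p.1 p.2} →
      MeasurablySeparable (f '' (A ∩ p.1)) (f '' (A ∩ p.2)) := by
    rintro ⟨U, V⟩ ⟨⟨hU, hV⟩, hUV⟩
    refine (hopen U hU).measurablySeparable (hopen V hV) ?_
    rw [Set.disjoint_left]
    rintro _ ⟨x, ⟨hxA, hxU⟩, rfl⟩ ⟨y, ⟨hyA, hyV⟩, hxy⟩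
    exact Set.disjoint_left.1 hUV hxU (hinj hyA hxA hxy ▸ hyV)
  choose! C hC₁ hC₂ hC using hsep
  have hcount : {p ∈ b ×ˢ b | Disjoint p.1 p.2}.Countable := (hbc.prod hbc).mono (sep_subset _ _)
  refine ⟨⋂ p ∈ {p ∈ b ×ˢ b | Disjoint p.1 p.2},
    (p.1ᶜ ∪ f ⁻¹' C p) ∩ (p.2ᶜ ∪ (f ⁻¹' C p)ᶜ), ?_, ?_, ?_⟩
  · intro x hx
    refine mem_iInter₂.2 fun p hp => ⟨?_, ?_⟩
    · by_cases h : x ∈ p.1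
      · exact Or.inr (hC₁ p hp ⟨x, ⟨hx, h⟩, rfl⟩)
      · exact Or.inl h
    · by_cases h : x ∈ p.2
      · exact Or.inr (Set.disjoint_left.1 (hC₂ p hp) ⟨x, ⟨hx, h⟩, rfl⟩)
      · exact Or.inl h
  · refine MeasurableSet.biInter hcount fun p hp => ?_
    have hm := hf.measurable (hC p hp)
    exact ((hb.isOpen hp.1.1).measurableSet.compl.union hm).inter
      ((hb.isOpen hp.1.2).measurableSet.compl.union hm.compl)
  · intro x hx y hy hxy
    by_contra hne
    obtain ⟨U', V', hU', hV', hxU', hyV', hUV'⟩ := t2_separation hne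
    obtain ⟨U, hU, hxU, hUU'⟩ := hb.exists_subset_of_mem_open hxU' hU'
    obtain ⟨V, hV, hyV, hVV'⟩ := hb.exists_subset_of_mem_open hyV' hV'
    have hp : (U, V) ∈ {p ∈ b ×ˢ b | Disjoint p.1 p.2} := ⟨⟨hU, hV⟩, hUV'.mono hUU' hVV'⟩
    have h₁ := ((mem_iInter₂.1 hx _ hp).1).resolve_left (not_not.2 hxU)
    have h₂ := ((mem_iInter₂.1 hy _ hp).2).resolve_left (not_not.2 hyV)
    exact h₂ (by simpa only [mem_preimage, hxy] using h₁)

/-- `N` is a countable union of Borel sets on each of which `f` is injective. -/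
def IsSigmaInjective {X Y : Type*} [MeasurableSpace X] (f : X → Y) (N : Set X) : Prop :=
  ∃ S : Set (Set X), S.Countable ∧ (∀ B ∈ S, MeasurableSet B ∧ InjOn f B) ∧ N = ⋃₀ S

namespace IsSigmaInjective

variable {X Y : Type*} [MeasurableSpace X] {f : X → Y}

theorem empty : IsSigmaInjective f ∅ := ⟨∅, by simp⟩

theorem of_injOn {B : Set X} (hB : MeasurableSet B) (hinj : InjOn f B) : IsSigmaInjective f B :=
  ⟨{B}, by simp [hB, hinj]⟩

theorem iUnion {ι : Type*} [Countable ι] {N : ι → Set X} (h : ∀ i, IsSigmaInjective f (N i)) :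
    IsSigmaInjective f (⋃ i, N i) := by
  choose S hS hinj hN using h
  refine ⟨⋃ i, S i, countable_iUnion hS, fun B hB => ?_, ?_⟩
  · obtain ⟨i, hi⟩ := mem_iUnion.1 hB
    exact hinj i B hi
  · rw [sUnion_iUnion]
    exact iUnion_congr hN

theorem union {M N : Set X} (hM : IsSigmaInjective f M) (hN : IsSigmaInjective f N) :
    IsSigmaInjective f (M ∪ N) := by
  rw [union_eq_iUnion]
  exact iUnion fun b => by cases b <;> assumption

theorem measurableSet {N : Set X} (hN : IsSigmaInjective f N) : MeasurableSet N := by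
  obtain ⟨S, hS, hinj, rfl⟩ := hN
  exact MeasurableSet.sUnion hS fun B hB => (hinj B hB).1

end IsSigmaInjective

/-- The sets `U i` meet a common fibre of `f`, even after removal of any countable union of Borel
sets on which `f` is injective. -/
def IsFibreLarge {X Y ι : Type*} [MeasurableSpace X] (f : X → Y) (U : ι → Set X) : Prop :=
  ∀ N, IsSigmaInjective f N → ∃ y, ∀ i, ∃ x ∈ U i \ N, f x = y

/-- A Cantor scheme whose levels each meet a common fibre of `f` yields an uncountable fibre. -/
theorem exists_not_countable_fibre_of_scheme {X Y : Type*} [MetricSpace X] [CompleteSpace X]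
    [TopologicalSpace Y] [T2Space Y] {f : X → Y} (hf : Continuous f) {A : List Bool → Set X}
    (hclosure : CantorScheme.ClosureAntitone A) (hdisj : CantorScheme.Disjoint A)
    (hdiam : CantorScheme.VanishingDiam A)
    (hfibre : ∀ n, ∃ y, ∀ l : List Bool, l.length = n → ∃ x ∈ A l, f x = y) :
    ∃ y, ¬ (f ⁻¹' {y}).Countable := by
  have hne : ∀ l, (A l).Nonempty := fun l => by
    obtain ⟨y, hy⟩ := hfibre l.length
    obtain ⟨x, hx, -⟩ := hy l rfl
    exact ⟨x, hx⟩
  have huniv := hclosure.map_of_vanishingDiam hdiam hne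
  let g : (ℕ → Bool) → X := fun z => (CantorScheme.inducedMap A).2 ⟨z, huniv ▸ mem_univ z⟩
  have hg : Function.Injective g := fun z w h => congrArg Subtype.val (hdisj.map_injective h)
  choose y hy using hfibre
  have hlim : ∀ z, Tendsto y atTop (𝓝 (f (g z))) := by
    intro z
    choose u hu huy using fun n => hy n (PiNat.res z n) (PiNat.res_length z n)
    have hu_lim : Tendsto u atTop (𝓝 (g z)) := by
      rw [tendsto_iff_edist_tendsto_0]
      exact tendsto_of_tendsto_of_tendsto_of_le_of_le tendsto_const_nhds (hdiam z)
        (fun _ => zero_le) fun n =>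
          Metric.edist_le_ediam_of_mem (hu n) (CantorScheme.map_mem (A := A) ⟨z, _⟩ n)
    exact ((hf.tendsto _).comp hu_lim).congr huy
  refine ⟨f (g fun _ => true), fun hcount => ?_⟩
  have hrange : range g ⊆ f ⁻¹' {f (g fun _ => true)} := by
    rintro _ ⟨z, rfl⟩
    exact tendsto_nhds_unique (hlim z) (hlim _)
  have hcantor : Countable (ℕ → Bool) := by
    rw [← countable_univ_iff]
    exact countable_of_injective_of_countable_image hg.injOn (image_univ ▸ hcount.mono hrange)
  have hle := Cardinal.mk_le_aleph0 (α := ℕ → Bool)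
  simp only [← Cardinal.power_def, Cardinal.mk_bool, Cardinal.mk_nat] at hle
  exact hle.not_gt (Cardinal.cantor _)

section Continuous

variable {X Y : Type*} [MeasurableSpace X] [MeasurableSpace Y]

/-- A large finite family of open sets has, off any countable union of Borel injectivity sets,
a fibre that meets each member twice. -/
theorem IsFibreLarge.exists_pairs {ι : Type*} [Finite ι]
    [TopologicalSpace X] [PolishSpace X] [BorelSpace X]
    [TopologicalSpace Y] [PolishSpace Y] [BorelSpace Y]
    {f : X → Y} (hf : Continuous f)
    {U : ι → Set X} (hU : ∀ i, IsOpen (U i)) (hlarge : IsFibreLarge f U)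
    {N : Set X} (hN : IsSigmaInjective f N) :
    ∃ y, ∀ i, ∃ x ∈ U i \ N, ∃ x' ∈ U i \ N, x ≠ x' ∧ f x = y ∧ f x' = y := by
  classical
  cases nonempty_fintype ι
  suffices H : ∀ s : Finset ι, ∀ N, IsSigmaInjective f N → ∃ y, (∀ i, ∃ x ∈ U i \ N, f x = y) ∧
      ∀ i ∈ s, ∃ x ∈ U i \ N, ∃ x' ∈ U i \ N, x ≠ x' ∧ f x = y ∧ f x' = y by
    obtain ⟨y, -, hy⟩ := H Finset.univ N hN
    exact ⟨y, fun i => hy i (Finset.mem_univ i)⟩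
  clear hN N
  intro s
  induction s using Finset.induction_on with
  | empty =>
    intro N hN
    obtain ⟨y, hy⟩ := hlarge N hN
    exact ⟨y, hy, by simp⟩
  | insert j s _ ih =>
    intro N hN
    have hm : ∀ i, MeasurableSet (U i \ N) := fun i => (hU i).measurableSet.diff hN.measurableSet
    let pairs : ι → Set (X × X) := fun i =>
      (U i \ N) ×ˢ (U i \ N) ∩ {p | p.1 = p.2}ᶜ ∩ {p | f p.1 = f p.2}
    have hpairs : ∀ i, AnalyticSet ((fun p : X × X => f p.1) '' pairs i) := by
      intro i
      refine MeasurableSet.analyticSet_image ?_ (hf.measurable.comp measurable_fst)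
      refine (((hm i).prod (hm i)).inter ?_).inter ?_
      · exact (measurableSet_eq_fun measurable_fst measurable_snd).compl
      · exact measurableSet_eq_fun (hf.measurable.comp measurable_fst)
          (hf.measurable.comp measurable_snd)
    let C : Set Y := (⋂ i : Option ι, i.elim univ fun i => f '' (U i \ N)) ∩
      ⋂ i : Option s, i.elim univ fun i => (fun p : X × X => f p.1) '' pairs i
    have hC : AnalyticSet C := by
      refine analyticSet_inter (AnalyticSet.iInter ?_) (AnalyticSet.iInter ?_)
      · rintro (_ | i)
        · exact MeasurableSet.univ.analyticSet
        · exact (hm i).analyticSet.image_of_continuous hf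
      · rintro (_ | i)
        · exact MeasurableSet.univ.analyticSet
        · exact hpairs i
    have mem_C : ∀ y, y ∈ C ↔ (∀ i, ∃ x ∈ U i \ N, f x = y) ∧
        ∀ i ∈ s, ∃ x ∈ U i \ N, ∃ x' ∈ U i \ N, x ≠ x' ∧ f x = y ∧ f x' = y := by
      intro y
      simp only [C, pairs, mem_inter_iff, mem_iInter, Option.forall, Option.elim, mem_univ,
        true_and, Subtype.forall]
      refine and_congr Iff.rfl (forall₂_congr fun i _ => ⟨?_, ?_⟩)
      · rintro ⟨⟨x, x'⟩, ⟨⟨⟨hx, hx'⟩, hne⟩, heq⟩, rfl⟩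
        exact ⟨x, hx, x', hx', hne, rfl, Eq.symm heq⟩
      · rintro ⟨x, hx, x', hx', hne, rfl, heq⟩
        exact ⟨(x, x'), ⟨⟨⟨hx, hx'⟩, hne⟩, heq.symm⟩, rfl⟩
    have hninj : ¬ InjOn f ((U j \ N) ∩ f ⁻¹' C) := by
      intro hinj
      obtain ⟨B, hAB, hB, hBinj⟩ := exists_measurableSet_injOn_of_analyticSet hf
        (analyticSet_inter (hm j).analyticSet (hC.preimage hf)) hinj
      obtain ⟨y, hy, hys⟩ := ih (N ∪ B) (hN.union (.of_injOn hB hBinj))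
      have hsub : ∀ i, U i \ (N ∪ B) ⊆ U i \ N := fun i => sdiff_subset_sdiff_right subset_union_left
      have hyC : y ∈ C := by
        refine (mem_C y).2 ⟨fun i => ?_, fun i hi => ?_⟩
        · obtain ⟨x, hx, h⟩ := hy i
          exact ⟨x, hsub i hx, h⟩
        · obtain ⟨x, hx, x', hx', h⟩ := hys i hi
          exact ⟨x, hsub i hx, x', hsub i hx', h⟩
      obtain ⟨x, hx, rfl⟩ := hy j
      exact hx.2 (Or.inr (hAB ⟨hsub j hx, hyC⟩))
    simp only [InjOn, not_forall] at hninj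
    obtain ⟨x, ⟨hx, hxC⟩, x', ⟨hx', -⟩, heq, hne⟩ := hninj
    obtain ⟨h₁, h₂⟩ := (mem_C _).1 hxC
    refine ⟨f x, h₁, fun i hi => ?_⟩
    rcases Finset.mem_insert.1 hi with rfl | hi
    · exact ⟨x, hx, x', hx', hne, rfl, heq.symm⟩
    · exact h₂ i hi

variable [MetricSpace X] [CompleteSpace X] [SecondCountableTopology X] [BorelSpace X]
  [TopologicalSpace Y] [PolishSpace Y] [BorelSpace Y] {f : X → Y}

/-- Each member of a large finite family of open sets can be split into two disjoint small open
pieces so that the family of all the pieces is still large. -/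
theorem IsFibreLarge.exists_split {ι : Type*} [Finite ι] (hf : Continuous f)
    {U : ι → Set X} (hU : ∀ i, IsOpen (U i)) (hlarge : IsFibreLarge f U)
    {ε : ENNReal} (hε : 0 < ε) :
    ∃ V : ι → Bool → Set X, (∀ i b, IsOpen (V i b)) ∧ (∀ i b, closure (V i b) ⊆ U i) ∧
      (∀ i, Disjoint (V i true) (V i false)) ∧ (∀ i b, Metric.ediam (V i b) ≤ ε) ∧
      IsFibreLarge f fun p : ι × Bool => V p.1 p.2 := by
  obtain ⟨b, hbc, -, hb⟩ := TopologicalSpace.exists_countable_basis X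
  let P : ι → Set (Set X × Set X) := fun i => {p | p ∈ b ×ˢ b ∧ Disjoint p.1 p.2 ∧
    (closure p.1 ⊆ U i ∧ Metric.ediam p.1 ≤ ε) ∧ closure p.2 ⊆ U i ∧ Metric.ediam p.2 ≤ ε}
  have hP : ∀ i, Countable (P i) := fun i =>
    ((hbc.prod hbc).mono fun p (hp : p ∈ P i) => hp.1).to_subtype
  have hsmall : ∀ i, ∀ x ∈ U i, ∀ W, IsOpen W → x ∈ W →
      ∃ V ∈ b, x ∈ V ∧ V ⊆ W ∧ closure V ⊆ U i ∧ Metric.ediam V ≤ ε := by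
    intro i x hx W hW hxW
    have hnhds : W ∩ U i ∩ Metric.eball x (ε / 2) ∈ 𝓝 x :=
      inter_mem (inter_mem (hW.mem_nhds hxW) ((hU i).mem_nhds hx))
        (Metric.eball_mem_nhds x (ENNReal.half_pos hε.ne'))
    obtain ⟨K, hK, hKc, hKs⟩ := exists_mem_nhds_isClosed_subset hnhds
    obtain ⟨V, hV, hxV, hVK⟩ := hb.mem_nhds_iff.1 hK
    refine ⟨V, hV, hxV, fun z hz => (hKs (hVK hz)).1.1,
      fun z hz => (hKs (closure_minimal hVK hKc hz)).1.2, ?_⟩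
    refine (Metric.ediam_mono fun z hz => (hKs (hVK hz)).2).trans ?_
    exact Metric.ediam_eball_le.trans (ENNReal.mul_div_cancel two_ne_zero ENNReal.ofNat_ne_top).le
  suffices H : ∃ p : ∀ i, P i,
      IsFibreLarge f fun q : ι × Bool => bif q.2 then (p q.1).1.1 else (p q.1).1.2 by
    obtain ⟨p, hp⟩ := H
    refine ⟨fun i c => bif c then (p i).1.1 else (p i).1.2, ?_, ?_, fun i => (p i).2.2.1, ?_, hp⟩
    · rintro i (_ | _)
      exacts [hb.isOpen (p i).2.1.2, hb.isOpen (p i).2.1.1]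
    · rintro i (_ | _)
      exacts [(p i).2.2.2.2.1, (p i).2.2.2.1.1]
    · rintro i (_ | _)
      exacts [(p i).2.2.2.2.2, (p i).2.2.2.1.2]
  by_contra! H
  simp only [IsFibreLarge, not_forall] at H
  choose N hN hNy using H
  obtain ⟨y, hy⟩ := hlarge.exists_pairs hf hU (IsSigmaInjective.iUnion hN)
  choose x hx x' hx' hne hxy hx'y using hy
  have hex : ∀ i, ∃ p : P i, x i ∈ p.1.1 ∧ x' i ∈ p.1.2 := by
    intro i
    obtain ⟨W, W', hW, hW', hxW, hxW', hWW'⟩ := t2_separation (hne i)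
    obtain ⟨V, hV, hxV, hVW, h⟩ := hsmall i _ (hx i).1 W hW hxW
    obtain ⟨V', hV', hxV', hVW', h'⟩ := hsmall i _ (hx' i).1 W' hW' hxW'
    exact ⟨⟨(V, V'), ⟨hV, hV'⟩, hWW'.mono hVW hVW', h, h'⟩, hxV, hxV'⟩
  choose p hp hp' using hex
  refine hNy p ⟨y, ?_⟩
  rintro ⟨i, _ | _⟩
  · exact ⟨x' i, ⟨hp' i, fun h => (hx' i).2 (mem_iUnion.2 ⟨p, h⟩)⟩, hx'y i⟩
  · exact ⟨x i, ⟨hp i, fun h => (hx i).2 (mem_iUnion.2 ⟨p, h⟩)⟩, hxy i⟩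

/-- A countable-to-one continuous map from a Polish space is injective on each piece of a countable
Borel cover. -/
theorem isSigmaInjective_univ_of_continuous (hf : Continuous f)
    (hcount : ∀ y, (f ⁻¹' {y}).Countable) : IsSigmaInjective f univ := by
  by_contra hX
  let Level : ℕ → Type _ := fun n =>
    {U : List.Vector Bool n → Set X // (∀ v, IsOpen (U v)) ∧ IsFibreLarge f U}
  have hlarge : IsFibreLarge f fun _ : List.Vector Bool 0 => (univ : Set X) := by
    intro N hN
    have hNu : N ≠ univ := fun h => hX (h ▸ hN)
    obtain ⟨x, hx⟩ := (ne_univ_iff_exists_notMem N).1 hNu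
    exact ⟨f x, fun _ => ⟨x, ⟨mem_univ x, hx⟩, rfl⟩⟩
  have hstep : ∀ n, ∀ U : Level n, ∃ U' : Level (n + 1),
      (∀ v b, closure (U'.1 (b ::ᵥ v)) ⊆ U.1 v) ∧
      (∀ v, Disjoint (U'.1 (true ::ᵥ v)) (U'.1 (false ::ᵥ v))) ∧
      ∀ v b, Metric.ediam (U'.1 (b ::ᵥ v)) ≤ ((n : ENNReal) + 1)⁻¹ := by
    intro n U
    obtain ⟨V, hopen, hcl, hdisj, hdiam, hV⟩ := U.2.2.exists_split hf U.2.1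
      (ε := ((n : ENNReal) + 1)⁻¹) (by simp)
    refine ⟨⟨fun v => V v.tail v.head, fun v => hopen _ _, fun N hN => ?_⟩, ?_, ?_, ?_⟩
    · obtain ⟨y, hy⟩ := hV N hN
      exact ⟨y, fun v => hy (v.tail, v.head)⟩
    · intro v b
      simpa using hcl v b
    · intro v
      simpa using hdisj v
    · intro v b
      simpa using hdiam v b
  choose next hclosure hdisj hdiam using hstep
  let L : ∀ n, Level n := fun n => Nat.rec ⟨_, fun _ => isOpen_univ, hlarge⟩ next n
  let A : List Bool → Set X := fun l => (L l.length).1 ⟨l, rfl⟩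
  have hA : ∀ l n (h : l.length = n), A l = (L n).1 ⟨l, h⟩ := by
    rintro l _ rfl
    rfl
  obtain ⟨y, hy⟩ := exists_not_countable_fibre_of_scheme hf (A := A)
    (fun l b => hclosure l.length (L l.length) ⟨l, rfl⟩ b)
    (fun l b c hbc => by
      have h := hdisj l.length (L l.length) ⟨l, rfl⟩
      cases b <;> cases c
      exacts [absurd rfl hbc, h.symm, h, absurd rfl hbc])
    (fun z => by
      rw [← tendsto_add_atTop_iff_nat 1]
      have hinv : Tendsto (fun n : ℕ => ((n : ENNReal) + 1)⁻¹) atTop (𝓝 0) := by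
        simpa using (tendsto_add_atTop_iff_nat 1).2 ENNReal.tendsto_inv_nat_nhds_zero
      refine tendsto_of_tendsto_of_tendsto_of_le_of_le tendsto_const_nhds hinv
        (fun _ => zero_le) fun n => ?_
      rw [hA _ (n + 1) (PiNat.res_length z (n + 1))]
      exact hdiam n (L n) ⟨PiNat.res z n, PiNat.res_length z n⟩ (z n))
    (fun n => by
      obtain ⟨y, hy⟩ := (L n).2.2 ∅ .empty
      refine ⟨y, fun l hl => ?_⟩
      obtain ⟨x, hx, hxy⟩ := hy ⟨l, hl⟩
      exact ⟨x, hA l n hl ▸ hx.1, hxy⟩)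
  exact hy (hcount y)

end Continuous

/-- **Lusin–Novikov** for maps: a countable-to-one Borel map between standard Borel spaces is
injective on each piece of a countable Borel cover. -/
theorem exists_measurableSet_cover_injOn {X Y : Type*} [MeasurableSpace X] [StandardBorelSpace X]
    [MeasurableSpace Y] [StandardBorelSpace Y] {f : X → Y} (hf : Measurable f)
    (hcount : ∀ y, (f ⁻¹' {y}).Countable) :
    ∃ B : ℕ → Set X, (∀ n, MeasurableSet (B n)) ∧ (∀ n, InjOn f (B n)) ∧ ⋃ n, B n = univ := by
  have hX : IsSigmaInjective f univ := by
    let tX := upgradeStandardBorel X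
    let := upgradeStandardBorel Y
    obtain ⟨t, ht, hfc, hpolish⟩ := hf.exists_continuous
    have hborel : @BorelSpace X t _ := by
      refine @BorelSpace.mk X t _ ?_
      rw [eq_borel_upgradeStandardBorel X]
      exact (borel_eq_borel_of_le hpolish tX.toPolishSpace ht).symm
    clear ht
    let := @TopologicalSpace.upgradeIsCompletelyMetrizable X t _
    exact isSigmaInjective_univ_of_continuous hfc hcount
  obtain ⟨S, hS, hinj, hSu⟩ := hX
  obtain ⟨B, hB⟩ := (hS.insert ∅).exists_eq_range (insert_nonempty _ _)
  have hmem : ∀ n, MeasurableSet (B n) ∧ InjOn f (B n) := by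
    intro n
    have hn : B n ∈ insert ∅ S := hB ▸ mem_range_self n
    rcases hn with hn | hn
    · simp [hn]
    · exact hinj _ hn
  refine ⟨B, fun n => (hmem n).1, fun n => (hmem n).2, ?_⟩
  rw [← sUnion_range, ← hB, sUnion_insert, ← hSu, empty_union]

/-- A Borel map into `ℕ → ℕ` is eventually dominated by one that factors through a given
countable-to-one Borel map. -/
theorem exists_measurable_evLe_comp {X Y : Type*} [MeasurableSpace X] [StandardBorelSpace X]
    [MeasurableSpace Y] [StandardBorelSpace Y] {f : X → Y} (hf : Measurable f)
    (hcount : ∀ y, (f ⁻¹' {y}).Countable) {φ : X → ℕ → ℕ} (hφ : Measurable φ) :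
    ∃ θ : Y → ℕ → ℕ, Measurable θ ∧ ∀ x, EvLe (φ x) (θ (f x)) := by
  obtain ⟨B, hB, hinj, hcover⟩ := exists_measurableSet_cover_injOn hf hcount
  have hext : ∀ n, ∃ h : Y → ℕ → ℕ, Measurable h ∧ ∀ x ∈ B n, h (f x) = φ x := by
    intro n
    have := (hB n).standardBorel
    obtain ⟨h, hm, heq⟩ := ((hf.comp measurable_subtype_coe).measurableEmbedding
      (hinj n).injective).exists_measurable_extend (hφ.comp measurable_subtype_coe)
        fun _ => inferInstance
    exact ⟨h, hm, fun x hx => congrFun heq ⟨x, hx⟩⟩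
  choose h hm heq using hext
  refine ⟨fun y k => (Finset.range (k + 1)).sup' Finset.nonempty_range_add_one fun n => h n y k,
    ?_, fun x => ?_⟩
  · refine measurable_pi_lambda _ fun k => ?_
    exact Finset.measurable_range_sup'' fun n _ => (measurable_pi_apply k).comp (hm n)
  · obtain ⟨n, hn⟩ := mem_iUnion.1 (hcover ▸ mem_univ x : x ∈ ⋃ n, B n)
    filter_upwards [eventually_ge_atTop n] with k hk
    rw [← heq n x hn]
    exact Finset.le_sup' (f := fun n => h n (f x) k) (Finset.mem_range.2 (by omega))

/-- If `E ≤_B F` (there is a Borel reduction from `E` to `F`) and `F` is Borel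
bounded, then `E` is Borel bounded. -/
theorem borelBounded_of_borelReducible
    {X Y : Type*} [MeasurableSpace X] [StandardBorelSpace X]
    [MeasurableSpace Y] [StandardBorelSpace Y]
    (E : X → X → Prop) (hEq : Equivalence E)
    (hEBorel : MeasurableSet {p : X × X | E p.1 p.2})
    (hECtble : ∀ x, {y | E x y}.Countable)
    (F : Y → Y → Prop) (hFeq : Equivalence F)
    (hFBorel : MeasurableSet {p : Y × Y | F p.1 p.2})
    (hFCtble : ∀ y, {z | F y z}.Countable)
    (f : X → Y) (hf : Measurable f) (hred : ∀ x y, E x y ↔ F (f x) (f y))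
    (hbb : BorelBounded F) :
    BorelBounded E := by
  intro φ hφ
  have hcount : ∀ y, (f ⁻¹' {y}).Countable := by
    intro y
    rcases (f ⁻¹' {y}).eq_empty_or_nonempty with h | ⟨x, hx⟩
    · simp [h]
    · refine (hECtble x).mono fun z hz => (hred x z).2 ?_
      rw [mem_singleton_iff.1 hx, mem_singleton_iff.1 hz]
      exact hFeq.refl y
  obtain ⟨θ, hθ, hφθ⟩ := exists_measurable_evLe_comp hf hcount hφ
  obtain ⟨ψ, hψ, hhom, hθψ⟩ := hbb θ hθ
  refine ⟨ψ ∘ f, hψ.comp hf, fun x y hxy => hhom _ _ ((hred x y).1 hxy), fun x => ?_⟩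
  filter_upwards [hφθ x, hθψ (f x)] with n h₁ h₂
  exact h₁.trans h₂
end

section
/- Let E be a countable Borel equivalence relation on a standard Borel space X, let 𝐀 be an invariant relation, and let Φ be a property of subsets of A₊. Suppose B ⊆ X is a Borel subset that is full for E, i.e. B meets every E-class. If the restriction E↾B is Borel non-(𝐀,Φ), then E is Borel non-(𝐀,Φ). -/
open Filter

/-- An invariant relation `𝐀 = (A₋, A₊, A)`: `A₋` and `A₊` are Borel subsets of
`ℕ^ℕ` (with `2^ℕ = 𝒫(ℕ)` regarded as `{0,1}`-valued functions), and the
relation `A` respects eventual equality on both sides. -/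
structure InvRelation where
  neg : Set (ℕ → ℕ)
  pos : Set (ℕ → ℕ)
  negBorel : MeasurableSet neg
  posBorel : MeasurableSet pos
  rel : (ℕ → ℕ) → (ℕ → ℕ) → Prop
  invariant : ∀ x x' y y', x ∈ neg → x' ∈ neg → y ∈ pos → y' ∈ pos →
    EvEq x x' → EvEq y y' → (rel x y ↔ rel x' y')

/-- `E` is Borel non-`(𝐀,Φ)`: for every Borel homomorphism `φ : X → (A₊)^ℕ`
from `E` to `E_set(A₊)` such that each family `{φ(x)(n) : n ∈ ℕ}` has property
`Φ`, there is a Borel homomorphism `ψ : X → A₋` from `E` to `E₀(A₋)` with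
`¬(ψ(x) A φ(x)(n))` for all `x` and `n`. -/
def BorelNonRel (A : InvRelation) (Φ : Set (ℕ → ℕ) → Prop)
    {X : Type*} [MeasurableSpace X] (E : X → X → Prop) : Prop :=
  ∀ φ : X → ℕ → ℕ → ℕ, Measurable φ → (∀ x n, φ x n ∈ A.pos) →
    (∀ x y, E x y → Set.range (φ x) = Set.range (φ y)) →
    (∀ x, Φ (Set.range (φ x))) →
    ∃ ψ : X → ℕ → ℕ, Measurable ψ ∧ (∀ x, ψ x ∈ A.neg) ∧
      (∀ x y, E x y → EvEq (ψ x) (ψ y)) ∧ ∀ x n, ¬ A.rel (ψ x) (φ x n)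

section LusinNovikov

open Set MeasureTheory TopologicalSpace

variable {Z X : Type*}

/-- The intersection of two analytic sets is analytic. -/
theorem MeasureTheory.AnalyticSet.inter [TopologicalSpace Z] [T2Space Z] {s t : Set Z}
    (hs : AnalyticSet s) (ht : AnalyticSet t) : AnalyticSet (s ∩ t) := by
  rw [inter_eq_iInter]
  exact AnalyticSet.iInter (by rintro (_ | _) <;> simpa)

/-- A set is small for `f` if it is a countable union of Borel sets on which `f` is injective. -/
def IsSmallFor [MeasurableSpace Z] (f : Z → X) (B : Set Z) : Prop :=
  ∃ 𝒞 : Set (Set Z), 𝒞.Countable ∧ (∀ C ∈ 𝒞, MeasurableSet C ∧ InjOn f C) ∧ ⋃₀ 𝒞 = B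

theorem IsSmallFor.measurableSet [MeasurableSpace Z] {f : Z → X} {B : Set Z}
    (hB : IsSmallFor f B) : MeasurableSet B := by
  obtain ⟨𝒞, h𝒞, h, rfl⟩ := hB
  exact .sUnion h𝒞 fun C hC => (h C hC).1

theorem isSmallFor_empty [MeasurableSpace Z] (f : Z → X) : IsSmallFor f ∅ :=
  ⟨∅, countable_empty, by simp, by simp⟩

theorem IsSmallFor.union [MeasurableSpace Z] {f : Z → X} {B C : Set Z} (hB : IsSmallFor f B)
    (hC : MeasurableSet C) (hfC : InjOn f C) : IsSmallFor f (B ∪ C) := by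
  obtain ⟨𝒞, h𝒞, h, rfl⟩ := hB
  refine ⟨insert C 𝒞, h𝒞.insert _, ?_, by rw [sUnion_insert, union_comm]⟩
  rintro D (rfl | hD)
  exacts [⟨hC, hfC⟩, h D hD]

theorem IsSmallFor.iUnion [MeasurableSpace Z] {f : Z → X} {ι : Type*} [Countable ι]
    {B : ι → Set Z} (hB : ∀ i, IsSmallFor f (B i)) : IsSmallFor f (⋃ i, B i) := by
  choose 𝒞 h𝒞 h hU using hB
  refine ⟨⋃ i, 𝒞 i, countable_iUnion h𝒞, fun C hC => ?_, ?_⟩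
  · obtain ⟨i, hi⟩ := mem_iUnion.1 hC
    exact h i C hi
  · rw [sUnion_iUnion]
    exact iUnion_congr hU

/-- A family `𝒱` of sets is null for `f` if, after removing a small set, no fibre of `f` meets
every member of `𝒱`. -/
def IsNullFor [MeasurableSpace Z] (f : Z → X) (𝒱 : Set (Set Z)) : Prop :=
  ∃ B, IsSmallFor f B ∧ ∀ x, ∃ V ∈ 𝒱, ∀ z ∈ V, f z = x → z ∈ B

/-- An analytic set on which a continuous map is injective is contained in a Borel set on which
the map is injective. -/
theorem MeasureTheory.AnalyticSet.exists_measurableSet_injOn [TopologicalSpace Z] [PolishSpace Z]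
    [MeasurableSpace Z] [BorelSpace Z] [TopologicalSpace X] [T2Space X] {f : Z → X}
    (hf : Continuous f) {A : Set Z} (hA : AnalyticSet A) (hfA : InjOn f A) :
    ∃ C, MeasurableSet C ∧ A ⊆ C ∧ InjOn f C := by
  let R : Set (Z × Z) := {p | f p.1 = f p.2 ∧ p.1 ≠ p.2}
  have hR : AnalyticSet R :=
    ((isClosed_eq (hf.comp continuous_fst) (hf.comp continuous_snd)).analyticSet).inter
      ((isOpen_ne_fun continuous_fst continuous_snd).measurableSet.analyticSet (α := Z × Z))
  have himg : ∀ {S : Set Z}, AnalyticSet S →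
      AnalyticSet {z | ∃ w ∈ S, f w = f z ∧ w ≠ z} := by
    intro S hS
    have := (hR.inter (hS.preimage continuous_fst)).image_of_continuous continuous_snd
    convert! this using 1
    ext z
    simp only [R, mem_ofPred_eq, mem_image, mem_inter_iff, mem_preimage, Prod.exists]
    constructor
    · rintro ⟨w, hw, h⟩
      exact ⟨w, z, ⟨h, hw⟩, rfl⟩
    · rintro ⟨w, _, ⟨h, hw⟩, rfl⟩
      exact ⟨w, hw, h⟩
  obtain ⟨C₁, hAC₁, hd₁, hC₁⟩ := hA.measurablySeparable (himg hA) <| by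
    rw [disjoint_left]
    rintro z hz ⟨w, hw, h, hne⟩
    exact hne (hfA hw hz h)
  obtain ⟨C₂, hAC₂, hd₂, hC₂⟩ := hA.measurablySeparable (himg hC₁.analyticSet) <| by
    rw [disjoint_left]
    rintro z hz ⟨w, hw, h, hne⟩
    exact disjoint_left.1 hd₁ ⟨z, hz, h.symm, hne.symm⟩ hw
  refine ⟨C₁ ∩ C₂, hC₁.inter hC₂, subset_inter hAC₁ hAC₂, fun w hw z hz h => ?_⟩
  by_contra hne
  exact disjoint_left.1 hd₂ ⟨w, hw.1, h, hne⟩ hz.2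

open scoped ENNReal

/-- A member of a non-null family can be split into two small disjoint basic open sets so that the
family obtained by adding them is still non-null. -/
theorem exists_splitting_of_not_isNullFor [MetricSpace Z] [PolishSpace Z]
    [MeasurableSpace Z] [BorelSpace Z] [TopologicalSpace X] [T2Space X] {f : Z → X}
    (hf : Continuous f) {b : Set (Set Z)} (hb : IsTopologicalBasis b) (hbc : b.Countable)
    {𝒱 : Set (Set Z)} (h𝒱c : 𝒱.Countable) (h𝒱o : ∀ V ∈ 𝒱, IsOpen V) (h𝒱 : ¬ IsNullFor f 𝒱)
    {U : Set Z} (hU : U ∈ 𝒱) {ε : ℝ≥0∞} (hε : 0 < ε) :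
    ∃ V₀ ∈ b, ∃ V₁ ∈ b, (closure V₀ ⊆ U ∧ Metric.ediam V₀ ≤ ε) ∧
      (closure V₁ ⊆ U ∧ Metric.ediam V₁ ≤ ε) ∧ Disjoint V₀ V₁ ∧
      ¬ IsNullFor f (insert V₀ (insert V₁ 𝒱)) := by
  by_contra! hnull
  let ι := {p : Set Z × Set Z // (p.1 ∈ b ∧ p.2 ∈ b) ∧ IsNullFor f (insert p.1 (insert p.2 𝒱))}
  have : Countable ι := ((hbc.prod hbc).mono fun p hp => hp.1 :
    {p : Set Z × Set Z | (p.1 ∈ b ∧ p.2 ∈ b) ∧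
      IsNullFor f (insert p.1 (insert p.2 𝒱))}.Countable).to_subtype
  choose B hB hBx using fun i : ι => i.2.2
  have hsmall : IsSmallFor f (⋃ i, B i) := .iUnion hB
  set D := ⋃ i, B i
  have : Countable 𝒱 := h𝒱c.to_subtype
  have : Nonempty 𝒱 := ⟨⟨U, hU⟩⟩
  have han : AnalyticSet ((U \ D) ∩ ⋂ V : 𝒱, f ⁻¹' (f '' (V.1 \ D))) :=
    ((h𝒱o U hU).measurableSet.diff hsmall.measurableSet).analyticSet.inter <|
      .iInter fun V => (((h𝒱o V V.2).measurableSet.diff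
        hsmall.measurableSet).analyticSet.image_of_continuous hf).preimage hf
  obtain ⟨C, hC, hAC, hCinj⟩ := han.exists_measurableSet_injOn hf <| by
    rintro z ⟨⟨hzU, hzD⟩, hz⟩ w ⟨⟨hwU, hwD⟩, -⟩ hzw
    by_contra hne
    obtain ⟨O, O', hO, hO', hzO, hwO', hOO'⟩ := t2_separation hne
    have hsub : ∀ y ∈ U, ∀ N, IsOpen N → y ∈ N →
        ∃ V ∈ b, y ∈ V ∧ V ⊆ N ∧ closure V ⊆ U ∧ Metric.ediam V ≤ ε := by
      intro y hyU N hN hyN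
      obtain ⟨V, hVb, hyV, hV⟩ := hb.exists_closure_subset
        ((((h𝒱o U hU).inter hN).inter (Metric.isOpen_eball (x := y) (ε := ε / 2))).mem_nhds
          ⟨⟨hyU, hyN⟩, Metric.mem_eball_self (ENNReal.half_pos hε.ne')⟩)
      refine ⟨V, hVb, hyV, fun v hv => (hV (subset_closure hv)).1.2, fun v hv => (hV hv).1.1, ?_⟩
      calc Metric.ediam V ≤ Metric.ediam (Metric.eball y (ε / 2)) :=
            Metric.ediam_mono fun v hv => (hV (subset_closure hv)).2
        _ ≤ 2 * (ε / 2) := Metric.ediam_eball_le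
        _ = ε := ENNReal.mul_div_cancel two_ne_zero ENNReal.ofNat_ne_top
    obtain ⟨V₀, hV₀b, hzV₀, hV₀O, hV₀⟩ := hsub z hzU O hO hzO
    obtain ⟨V₁, hV₁b, hwV₁, hV₁O, hV₁⟩ := hsub w hwU O' hO' hwO'
    let i : ι := ⟨(V₀, V₁), ⟨hV₀b, hV₁b⟩,
      hnull V₀ hV₀b V₁ hV₁b hV₀ hV₁ (hOO'.mono hV₀O hV₁O)⟩
    have hiD : B i ⊆ D := subset_iUnion B i
    obtain ⟨V, rfl | rfl | hV, hVB⟩ := hBx i (f z)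
    · exact hzD (hiD (hVB z hzV₀ rfl))
    · exact hwD (hiD (hVB w hwV₁ hzw.symm))
    · obtain ⟨v, ⟨hv, hvD⟩, hvz⟩ := mem_iInter.1 hz ⟨V, hV⟩
      exact hvD (hiD (hVB v hv hvz))
  refine h𝒱 ⟨D ∪ C, hsmall.union hC hCinj, fun x => ?_⟩
  by_contra! hx
  obtain ⟨z, hzU, rfl, hz⟩ := hx U hU
  rw [mem_union, not_or] at hz
  refine hz.2 (hAC ⟨⟨hzU, hz.1⟩, mem_iInter.2 fun V => ?_⟩)
  obtain ⟨v, hvV, hvz, hv⟩ := hx V V.2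
  exact ⟨v, ⟨hvV, fun h => hv (.inl h)⟩, hvz⟩

open CantorScheme PiNat in
/-- If a family of sets splits at every scale and any two members meet a common fibre of a
continuous map `f`, then some fibre of `f` is uncountable. -/
theorem exists_not_countable_fiber_of_splitting [MetricSpace Z] [CompleteSpace Z]
    [TopologicalSpace X] [T2Space X] {f : Z → X} (hf : Continuous f) {𝒪 : Set (Set Z)}
    (hne : 𝒪.Nonempty) (hmeet : ∀ U ∈ 𝒪, ∀ V ∈ 𝒪, ∃ u ∈ U, ∃ v ∈ V, f u = f v)
    (hsplit : ∀ U ∈ 𝒪, ∀ n : ℕ, ∃ V₀ ∈ 𝒪, ∃ V₁ ∈ 𝒪,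
      (closure V₀ ⊆ U ∧ Metric.ediam V₀ ≤ (n : ℝ≥0∞)⁻¹) ∧
      (closure V₁ ⊆ U ∧ Metric.ediam V₁ ≤ (n : ℝ≥0∞)⁻¹) ∧ Disjoint V₀ V₁) :
    ∃ x, ¬ (f ⁻¹' {x}).Countable := by
  obtain ⟨W, hW⟩ := hne
  choose! C₀ hC₀ C₁ hC₁ h₀ h₁ hdisj using hsplit
  let D : List Bool → Set Z := fun l =>
    l.rec W fun a l U => if a then C₁ U l.length else C₀ U l.length
  have hD : ∀ a l, D (a :: l) = if a then C₁ (D l) l.length else C₀ (D l) l.length :=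
    fun _ _ => rfl
  have hD𝒪 : ∀ l, D l ∈ 𝒪 := by
    intro l
    induction l with
    | nil => exact hW
    | cons a l ih =>
      cases a
      · exact hC₀ _ ih _
      · exact hC₁ _ ih _
  have hanti : ClosureAntitone D := by
    rintro l (_ | _)
    · exact (h₀ _ (hD𝒪 l) _).1
    · exact (h₁ _ (hD𝒪 l) _).1
  have hdiam : VanishingDiam D := by
    intro x
    rw [← Filter.tendsto_add_atTop_iff_nat 1]
    refine tendsto_of_tendsto_of_tendsto_of_le_of_le tendsto_const_nhds
      ENNReal.tendsto_inv_nat_nhds_zero (fun _ => zero_le) fun n => ?_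
    simp only [res_succ, hD, res_length]
    cases x n
    · exact (h₀ _ (hD𝒪 _) _).2
    · exact (h₁ _ (hD𝒪 _) _).2
  have hdisj' : CantorScheme.Disjoint D := by
    rintro l (_ | _) (_ | _) hab
    · exact absurd rfl hab
    · exact hdisj _ (hD𝒪 l) _
    · exact (hdisj _ (hD𝒪 l) _).symm
    · exact absurd rfl hab
  have hdom : ∀ x : ℕ → Bool, x ∈ (inducedMap D).1 := fun x => by
    rw [hanti.map_of_vanishingDiam hdiam fun l => ?_]
    · exact mem_univ _
    · obtain ⟨u, hu, -⟩ := hmeet _ (hD𝒪 l) _ (hD𝒪 l)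
      exact ⟨u, hu⟩
  let g : (ℕ → Bool) → Z := fun x => (inducedMap D).2 ⟨x, hdom x⟩
  have hg : ∀ x n, g x ∈ D (res x n) := fun x n => map_mem ⟨x, hdom x⟩ n
  have hginj : Function.Injective g := fun x y hxy => by
    simpa only [← Subtype.val_inj] using hdisj'.map_injective hxy
  have hnhds : ∀ x, ∀ O : Set X, IsOpen O → f (g x) ∈ O → ∃ n, ∀ z ∈ D (res x n), f z ∈ O := by
    intro x O hO hxO
    obtain ⟨ε, hε, hball⟩ := Metric.isOpen_iff.1 (hO.preimage hf) (g x) hxO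
    obtain ⟨n, hn⟩ := hdiam.dist_lt ε hε x
    exact ⟨n, fun z hz => hball (hn z hz _ (hg x n))⟩
  have hconst : ∀ x y, f (g x) = f (g y) := by
    intro x y
    by_contra hxy
    obtain ⟨O, O', hO, hO', hx, hy, hOO'⟩ := t2_separation hxy
    obtain ⟨n, hn⟩ := hnhds x O hO hx
    obtain ⟨m, hm⟩ := hnhds y O' hO' hy
    obtain ⟨u, hu, v, hv, huv⟩ := hmeet _ (hD𝒪 (res x n)) _ (hD𝒪 (res y m))
    exact disjoint_left.1 hOO' (hn u hu) (huv ▸ hm v hv)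
  refine ⟨f (g fun _ => false), fun hcount => ?_⟩
  have : Countable (f ⁻¹' {f (g fun _ => false)}) := hcount.to_subtype
  have hcard : Cardinal.mk (ℕ → Bool) = Cardinal.continuum := by simp
  have : Countable (ℕ → Bool) := Function.Injective.countable
    (f := fun x => (⟨g x, hconst _ _⟩ : f ⁻¹' {f (g fun _ => false)}))
    fun x y hxy => hginj (congrArg Subtype.val hxy)
  exact Cardinal.aleph0_lt_continuum.not_ge (hcard ▸ Cardinal.mk_le_aleph0)

/-- A continuous countable-to-one map on a Polish space is injective on each piece of some
countable Borel cover. -/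
theorem Continuous.isSmallFor_univ [TopologicalSpace Z] [PolishSpace Z] [MeasurableSpace Z]
    [BorelSpace Z] [TopologicalSpace X] [T2Space X] {f : Z → X} (hf : Continuous f)
    (hcount : ∀ x, (f ⁻¹' {x}).Countable) : IsSmallFor f univ := by
  by_contra hlarge
  let := TopologicalSpace.upgradeIsCompletelyMetrizable Z
  let b := insert univ (countableBasis Z)
  have hbc : b.Countable := (countable_countableBasis Z).insert _
  have hbo : ∀ V ∈ b, IsOpen V := by
    rintro V (rfl | hV)
    exacts [isOpen_univ, isOpen_of_mem_countableBasis hV]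
  let P := {𝒱 : Set (Set Z) // 𝒱 ⊆ b ∧ ¬ IsNullFor f 𝒱}
  let p₀ : P := ⟨{univ}, by simp [b], by
    rintro ⟨B, hB, hBx⟩
    refine hlarge ?_
    convert! hB
    refine (eq_univ_of_forall fun z => ?_).symm
    obtain ⟨V, rfl, hV⟩ := hBx (f z)
    exact hV z trivial rfl⟩
  let good (U : Set Z) (n : ℕ) (𝒱 : Set (Set Z)) : Prop := ∃ V₀ ∈ 𝒱, ∃ V₁ ∈ 𝒱,
      (closure V₀ ⊆ U ∧ Metric.ediam V₀ ≤ (n : ℝ≥0∞)⁻¹) ∧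
      (closure V₁ ⊆ U ∧ Metric.ediam V₁ ≤ (n : ℝ≥0∞)⁻¹) ∧ Disjoint V₀ V₁
  have : Countable b := hbc.to_subtype
  let := Encodable.ofCountable b
  let 𝒟 : b × ℕ → Order.Cofinal P := fun i =>
    { carrier := {p | good i.1 i.2 p.1 ∨ ∀ q : P, p ≤ q → i.1.1 ∉ q.1}
      isCofinal := fun p => by
        by_cases h : ∀ q : P, p ≤ q → i.1.1 ∉ q.1
        · exact ⟨p, .inr h, le_rfl⟩
        · push Not at h
          obtain ⟨q, hpq, hiq⟩ := h
          obtain ⟨V₀, h₀, V₁, h₁, h₀', h₁', hd, hn⟩ := exists_splitting_of_not_isNullFor hf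
            (isBasis_countableBasis Z) (countable_countableBasis Z) (hbc.mono q.2.1)
            (fun V hV => hbo V (q.2.1 hV)) q.2.2 hiq
            (ε := (i.2 : ℝ≥0∞)⁻¹) (by simp)
          refine ⟨⟨insert V₀ (insert V₁ q.1), ?_, hn⟩, .inl ?_, hpq.trans ?_⟩
          · exact insert_subset (.inr h₀) (insert_subset (.inr h₁) q.2.1)
          · exact ⟨V₀, .inl rfl, V₁, .inr (.inl rfl), h₀', h₁', hd⟩
          · exact fun V hV => .inr (.inr hV) }
  let I := Order.idealOfCofinals p₀ 𝒟
  obtain ⟨x, hx⟩ := exists_not_countable_fiber_of_splitting hf (𝒪 := {U | ∃ p ∈ I, U ∈ p.1})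
    ⟨univ, p₀, Order.mem_idealOfCofinals p₀ 𝒟, rfl⟩
    (by
      rintro U ⟨p, hp, hU⟩ V ⟨q, hq, hV⟩
      obtain ⟨r, hr, hpr, hqr⟩ := I.directed p hp q hq
      by_contra! hUV
      refine r.2.2 ⟨∅, isSmallFor_empty f, fun x => ?_⟩
      by_contra! hx
      obtain ⟨u, hu, hux, -⟩ := hx U (hpr hU)
      obtain ⟨v, hv, hvx, -⟩ := hx V (hqr hV)
      exact hUV u hu v hv (hux.trans hvx.symm))
    (by
      rintro U ⟨p, hp, hU⟩ n
      obtain ⟨q, hqD, hq⟩ :=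
        Order.cofinal_meets_idealOfCofinals p₀ 𝒟 (⟨U, p.2.1 hU⟩, n)
      rcases hqD with ⟨V₀, h₀, V₁, h₁, h⟩ | hqD
      · exact ⟨V₀, ⟨q, hq, h₀⟩, V₁, ⟨q, hq, h₁⟩, h⟩
      · obtain ⟨r, hr, hpr, hqr⟩ := I.directed p hp q hq
        exact absurd (hpr hU) (hqD r hqr))
  exact hx (hcount x)

/-- A Borel countable-to-one map between standard Borel spaces is injective on each piece of some
countable Borel cover. -/
theorem Measurable.isSmallFor_univ [MeasurableSpace Z] [StandardBorelSpace Z] [MeasurableSpace X]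
    [StandardBorelSpace X] {f : Z → X} (hf : Measurable f)
    (hcount : ∀ x, (f ⁻¹' {x}).Countable) : IsSmallFor f univ := by
  let τ := upgradeStandardBorel Z
  let := upgradeStandardBorel X
  obtain ⟨t, ht, hfc, hpol⟩ := hf.exists_continuous
  have hborel : @BorelSpace Z t _ :=
    @BorelSpace.mk _ t _ <| (eq_borel_upgradeStandardBorel Z).trans <|
      (borel_eq_borel_of_le hpol τ.toPolishSpace ht).symm
  exact @Continuous.isSmallFor_univ Z X t hpol _ hborel _ _ f hfc hcount

/-- **Lusin–Novikov uniformization**: a Borel countable-to-one surjection between standard Borel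
spaces has a Borel section. -/
theorem Measurable.exists_measurable_rightInverse [MeasurableSpace Z] [StandardBorelSpace Z]
    [MeasurableSpace X] [StandardBorelSpace X] {f : Z → X} (hf : Measurable f)
    (hcount : ∀ x, (f ⁻¹' {x}).Countable) (hsurj : Function.Surjective f) :
    ∃ g : X → Z, Measurable g ∧ Function.RightInverse g f := by
  obtain ⟨𝒞, h𝒞, h, hU⟩ := hf.isSmallFor_univ hcount
  obtain ⟨C, hC⟩ := (h𝒞.insert ∅).exists_eq_range (insert_nonempty _ _)
  have hCmem : ∀ n, MeasurableSet (C n) ∧ InjOn f (C n) := by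
    intro n
    rcases (hC ▸ mem_range_self n : C n ∈ insert ∅ 𝒞) with h' | h'
    · simp [h']
    · exact h _ h'
  have hcover : ∀ z, ∃ n, z ∈ C n := by
    intro z
    obtain ⟨S, hS, hzS⟩ := mem_sUnion.1 (hU ▸ mem_univ z : z ∈ ⋃₀ 𝒞)
    obtain ⟨n, rfl⟩ := (hC ▸ mem_insert_of_mem _ hS : S ∈ range C)
    exact ⟨n, hzS⟩
  let D : Set Z := ⋃ n, C n \ ⋃ m < n, f ⁻¹' (f '' C m)
  have hD : MeasurableSet D := .iUnion fun n => (hCmem n).1.diff <| .iUnion fun m => .iUnion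
    fun _ => hf ((hCmem m).1.image_of_measurable_injOn hf (hCmem m).2)
  have hDmem : ∀ {z}, z ∈ D ↔ ∃ n, z ∈ C n ∧ ∀ m < n, ∀ w ∈ C m, f w ≠ f z := by
    intro z
    simp [D]
  have hinj : InjOn f D := by
    intro z hz w hw hzw
    obtain ⟨n, hzn, hn⟩ := hDmem.1 hz
    obtain ⟨m, hwm, hm⟩ := hDmem.1 hw
    rcases lt_trichotomy n m with hlt | rfl | hlt
    · exact absurd hzw (hm n hlt z hzn)
    · exact (hCmem n).2 hzn hwm hzw
    · exact absurd hzw.symm (hn m hlt w hwm)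
  have hDsurj : ∀ x, ∃ z : D, f z = x := by
    classical
    intro x
    have hex : ∃ n, ∃ z ∈ C n, f z = x := by
      obtain ⟨z, rfl⟩ := hsurj x
      obtain ⟨n, hn⟩ := hcover z
      exact ⟨n, z, hn, rfl⟩
    obtain ⟨z, hz, hzx⟩ := Nat.find_spec hex
    refine ⟨⟨z, hDmem.2 ⟨_, hz, fun m hm w hw hwz => ?_⟩⟩, hzx⟩
    exact Nat.find_min hex hm ⟨w, hw, hwz.trans hzx⟩
  choose g hg using hDsurj
  have := hD.standardBorel
  have hemb : MeasurableEmbedding fun z : D => f z :=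
    (hf.comp measurable_subtype_coe).measurableEmbedding (injOn_iff_injective.1 hinj)
  refine ⟨fun x => g x, measurable_subtype_coe.comp (hemb.measurable_comp_iff.1 ?_), hg⟩
  convert! measurable_id
  exact funext hg

end LusinNovikov

/-- If `B ⊆ X` is a Borel set meeting every `E`-class and the restriction
`E ↾ B` is Borel non-`(𝐀,Φ)`, then `E` is Borel non-`(𝐀,Φ)`. -/
theorem borelNonRel_of_full_restriction
    {X : Type*} [MeasurableSpace X] [StandardBorelSpace X]
    (A : InvRelation) (Φ : Set (ℕ → ℕ) → Prop)
    (E : X → X → Prop)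
    (hEeq : Equivalence E) (hEBorel : MeasurableSet {p : X × X | E p.1 p.2})
    (hECtble : ∀ x, {y | E x y}.Countable)
    (B : Set X) (hB : MeasurableSet B)
    (hfull : ∀ x, ∃ y ∈ B, E x y)
    (hres : BorelNonRel A Φ (fun b b' : B => E b.1 b'.1)) :
    BorelNonRel A Φ E := by
  intro φ hφ hφpos hφE hφΦ
  let P : Set (X × X) := {p | E p.1 p.2} ∩ Prod.snd ⁻¹' B
  have := (hEBorel.inter (measurable_snd hB) : MeasurableSet P).standardBorel
  have hfst : Measurable fun p : P => p.1.1 := measurable_fst.comp measurable_subtype_coe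
  obtain ⟨g, hg, hgfst⟩ := hfst.exists_measurable_rightInverse
    (fun x => by
      refine (((hECtble x).image (Prod.mk x)).preimage Subtype.val_injective).mono ?_
      rintro p rfl
      exact ⟨p.1.2, p.2.1, rfl⟩)
    (fun x => by
      obtain ⟨y, hy, hxy⟩ := hfull x
      exact ⟨⟨(x, y), hxy, hy⟩, rfl⟩)
  let r : X → B := fun x => ⟨(g x).1.2, (g x).2.2⟩
  have hr : Measurable r :=
    (measurable_snd.comp (measurable_subtype_coe.comp hg)).subtype_mk
  have hEr : ∀ x, E x (r x) := fun x => by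
    have h : E (g x).1.1 (r x) := (g x).2.1
    rwa [show (g x).1.1 = x from hgfst x] at h
  obtain ⟨ψ, hψ, hψneg, hψE, hψA⟩ := hres (fun y => φ y) (hφ.comp measurable_subtype_coe)
    (fun y => hφpos y) (fun y z => hφE y z) (fun y => hφΦ y)
  refine ⟨fun x => ψ (r x), hψ.comp hr, fun x => hψneg (r x), fun x y hxy =>
    hψE _ _ (hEeq.trans (hEeq.symm (hEr x)) (hEeq.trans hxy (hEr y))), fun x n hA => ?_⟩
  obtain ⟨m, hm⟩ := (hφE x (r x) (hEr x) ▸ Set.mem_range_self n : φ x n ∈ Set.range (φ (r x)))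
  exact hψA (r x) m (hm ▸ hA)
end
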